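/- arXiv:2205.06314 — 3 statements merged into one kernel-verified Lean document; each statement's English description precedes it below -/
import Mathlib

section
/- If round r is accepted, t ≤ r, and t is not skippable, then t = r or t is an ancestor of r. -/
/-- `Ancestor accepted par s r` means round `s` is an ancestor of round `r`:
`s` is reached from `r` by iterating the parent function `par` one or more
times, i.e. the transitive closure of `{(s, r) : accepted r ∧ par r = some s}`. -/
def Ancestor (accepted : ℕ → Prop) (par : ℕ → Option ℕ) : ℕ → ℕ → Prop :=
  Relation.TransGen (fun s r => accepted r ∧ par r = some s)

/-- **Non-skippable earlier rounds are ancestors.** If round `r` is accepted,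
`t ≤ r`, and `t` is not skippable, then `t = r` or `t` is an ancestor of `r`. -/
theorem nonskippable_le_accepted_is_ancestor
    (skippable committed accepted : ℕ → Prop) (par : ℕ → Option ℕ)
    (hpar : ∀ r s, accepted r → par r = some s →
      s < r ∧ accepted s ∧ ∀ t, s < t → t < r → skippable t)
    (hroot : ∀ r, accepted r → par r = none → ∀ t, t < r → skippable t)
    (hcs : ∀ r, ¬(committed r ∧ skippable r))
    (r t : ℕ) (hr : accepted r) (htr : t ≤ r) (ht : ¬ skippable t) :
    t = r ∨ Ancestor accepted par t r := by
  induction r using Nat.strong_induction_on with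
  | _ r ih =>
    obtain rfl | hlt := htr.eq_or_lt
    · exact Or.inl rfl
    · right
      cases hp : par r with
      | none => exact absurd (hroot r hr hp t hlt) ht
      | some s =>
        obtain ⟨hsr, hs, hskip⟩ := hpar r s hr hp
        have hts : t ≤ s := not_lt.mp fun hst => ht (hskip t hst hlt)
        obtain rfl | hanc := ih s hsr hs hts
        · exact .single ⟨hr, hp⟩
        · exact .tail hanc ⟨hr, hp⟩
end

section
/- If round r₁ is committed, round r₂ is accepted, and r₁ ≤ r₂, then r₁ = r₂ or r₁ is an ancestor of r₂. -/
/-- **Committed rounds below an accepted round are its ancestors.** If round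
`r₁` is committed, round `r₂` is accepted, and `r₁ ≤ r₂`, then `r₁ = r₂` or
`r₁` is an ancestor of `r₂`. -/
theorem committed_le_accepted_is_ancestor
    (skippable committed accepted : ℕ → Prop) (par : ℕ → Option ℕ)
    (hpar : ∀ r s, accepted r → par r = some s →
      s < r ∧ accepted s ∧ ∀ t, s < t → t < r → skippable t)
    (hroot : ∀ r, accepted r → par r = none → ∀ t, t < r → skippable t)
    (hcs : ∀ r, ¬(committed r ∧ skippable r))
    (r₁ r₂ : ℕ) (h₁ : committed r₁) (h₂ : accepted r₂) (h : r₁ ≤ r₂) :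
    r₁ = r₂ ∨ Ancestor accepted par r₁ r₂ := by
  induction r₂ using Nat.strong_induction_on with
  | _ r₂ ih =>
    rcases h.eq_or_lt with heq | hlt
    · exact Or.inl heq
    right
    cases hp : par r₂ with
    | none => exact absurd ⟨h₁, hroot r₂ h₂ hp r₁ hlt⟩ (hcs r₁)
    | some s =>
      obtain ⟨hsr, hs, hskip⟩ := hpar r₂ s h₂ hp
      have hle : r₁ ≤ s := by
        by_contra! hlt'
        exact hcs r₁ ⟨h₁, hskip r₁ hlt' hlt⟩
      rcases ih s hsr hs hle with rfl | hanc
      · exact Relation.TransGen.single ⟨h₂, hp⟩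
      · exact Relation.TransGen.tail hanc ⟨h₂, hp⟩
end

section
/- If rounds r₁ and r₂ are both finalized, then r₁ = r₂, or r₁ is an ancestor of r₂, or r₂ is an ancestor of r₁. -/
/-- A round `r` is finalized if some round `r'` is both committed and accepted
and `r = r'` or `r` is an ancestor of `r'`. -/
def Finalized (committed accepted : ℕ → Prop) (par : ℕ → Option ℕ) (r : ℕ) : Prop :=
  ∃ r', committed r' ∧ accepted r' ∧ (r = r' ∨ Ancestor accepted par r r')

/-- A committed round is reached by iterating the parent function from any accepted round that is
not below it. -/
theorem reflTransGen_of_committed_le {skippable committed accepted : ℕ → Prop}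
    {par : ℕ → Option ℕ}
    (hpar : ∀ r s, accepted r → par r = some s →
      s < r ∧ accepted s ∧ ∀ t, s < t → t < r → skippable t)
    (hroot : ∀ r, accepted r → par r = none → ∀ t, t < r → skippable t)
    (hcs : ∀ r, ¬(committed r ∧ skippable r))
    {c r : ℕ} (hc : committed c) (hr : accepted r) (hcr : c ≤ r) :
    Relation.ReflTransGen (fun s r => accepted r ∧ par r = some s) c r := by
  induction r using Nat.strong_induction_on with
  | _ r ih =>
    rcases hcr.eq_or_lt with rfl | hlt
    · exact .refl
    cases hp : par r with
    | none => exact absurd ⟨hc, hroot r hr hp c hlt⟩ (hcs c)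
    | some s =>
      obtain ⟨hsr, hs, hskip⟩ := hpar r s hr hp
      have hcs' : c ≤ s := not_lt.mp fun h => hcs c ⟨hc, hskip c h hlt⟩
      exact (ih s hsr hs hcs').tail ⟨hr, hp⟩

/-- Two rounds reached by iterating the parent function from the same round are comparable. -/
theorem eq_or_ancestor_of_reflTransGen {accepted : ℕ → Prop} {par : ℕ → Option ℕ} {a b r : ℕ}
    (ha : Relation.ReflTransGen (fun s r => accepted r ∧ par r = some s) a r)
    (hb : Relation.ReflTransGen (fun s r => accepted r ∧ par r = some s) b r) :
    a = b ∨ Ancestor accepted par a b ∨ Ancestor accepted par b a := by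
  have hunique : Relator.RightUnique
      (Function.swap fun s r => accepted r ∧ par r = some s) :=
    fun _ _ _ h h' => Option.some.inj (h.2.symm.trans h'.2)
  rcases Relation.ReflTransGen.total_of_right_unique hunique ha.swap hb.swap with h | h
  · rcases Relation.reflTransGen_iff_eq_or_transGen.mp h.swap with h | h
    exacts [.inl h, .inr (.inr h)]
  · rcases Relation.reflTransGen_iff_eq_or_transGen.mp h.swap with h | h
    exacts [.inl h.symm, .inr (.inl h)]

/-- **Finalized rounds form a chain.** If rounds `r₁` and `r₂` are both
finalized, then `r₁ = r₂`, or `r₁` is an ancestor of `r₂`, or `r₂` is an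
ancestor of `r₁`. -/
theorem finalized_chain
    (skippable committed accepted : ℕ → Prop) (par : ℕ → Option ℕ)
    (hpar : ∀ r s, accepted r → par r = some s →
      s < r ∧ accepted s ∧ ∀ t, s < t → t < r → skippable t)
    (hroot : ∀ r, accepted r → par r = none → ∀ t, t < r → skippable t)
    (hcs : ∀ r, ¬(committed r ∧ skippable r))
    (r₁ r₂ : ℕ)
    (h₁ : Finalized committed accepted par r₁)
    (h₂ : Finalized committed accepted par r₂) :
    r₁ = r₂ ∨ Ancestor accepted par r₁ r₂ ∨ Ancestor accepted par r₂ r₁ := by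
  obtain ⟨c₁, hc₁, ha₁, h₁⟩ := h₁
  obtain ⟨c₂, hc₂, ha₂, h₂⟩ := h₂
  replace h₁ := Relation.reflTransGen_iff_eq_or_transGen.mpr (h₁.imp_left Eq.symm)
  replace h₂ := Relation.reflTransGen_iff_eq_or_transGen.mpr (h₂.imp_left Eq.symm)
  rcases le_total c₁ c₂ with hle | hle
  · exact eq_or_ancestor_of_reflTransGen
      (h₁.trans (reflTransGen_of_committed_le hpar hroot hcs hc₁ ha₂ hle)) h₂
  · exact eq_or_ancestor_of_reflTransGen h₁
      (h₂.trans (reflTransGen_of_committed_le hpar hroot hcs hc₂ ha₁ hle))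
end
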